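/- arXiv:1106.3975 — 4 statements merged into one kernel-verified Lean document; each statement's English description precedes it below -/
import Mathlib

section
/- Let F be a field of characteristic zero, let n ≥ 1 and 0 ≤ a ≤ n−1 be integers, let α_0, …, α_a ∈ F be pairwise distinct, and let β_0, …, β_{n−a−1} ∈ F be pairwise distinct. Then ∑_{i=0}^{a} ∑_{j=0}^{n−a−1} ( ∏_{A=1}^{n−1} (A·α_i + (n−A)·β_j) ) / ( (∏_{I≠i, 0≤I≤a} (α_i − α_I)) · (∏_{J≠j, 0≤J≤n−a−1} (β_j − β_J)) ) = τ_{a,n}. (This is the virtual localization sum which computes the Gromov–Witten coefficient A_a = n²·τ_{a,n} in Theorem 7.5; in particular the sum is the integer τ_{a,n}.) -/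
theorem aux_D {F : Type*} [Field F] (m k : ℕ) (hk : k < m) (v : Fin m → F)
    (hv : Function.Injective v) :
    ∑ i : Fin m, v i ^ k / (∏ I ∈ Finset.univ.erase i, (v i - v I))
      = if k + 1 = m then 1 else 0 := by
  have h := Lagrange.coeff_eq_sum (s := Finset.univ) (v := v) hv.injOn
    (P := (Polynomial.X ^ k : Polynomial F))
    (by rw [Polynomial.degree_X_pow]; simpa using hk)
  simp only [Polynomial.eval_pow, Polynomial.eval_X, Finset.card_univ, Fintype.card_fin,
    Polynomial.coeff_X_pow] at h
  rw [← h]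
  exact if_congr (by omega) rfl rfl

theorem aux_hom {F : Type*} [Field F] (S : Finset ℕ) (u v : ℕ → ℕ) (x y : F) :
    (∏ A ∈ S, (Polynomial.C (u A : ℤ) * Polynomial.X + Polynomial.C (v A : ℤ))).natDegree ≤ S.card ∧
    ∏ A ∈ S, ((u A : F) * x + (v A : F) * y) =
      ∑ k ∈ Finset.range (S.card + 1),
        (((∏ A ∈ S, (Polynomial.C (u A : ℤ) * Polynomial.X + Polynomial.C (v A : ℤ))).coeff k : ℤ) : F)
          * (x ^ k * y ^ (S.card - k)) := by
  classical
  induction S using Finset.induction_on with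
  | empty => simp
  | insert A S hA ih =>
    obtain ⟨hd, ih⟩ := ih
    rw [Finset.prod_insert hA, Finset.prod_insert hA, Finset.card_insert_of_notMem hA, ih]
    generalize (∏ A ∈ S, (Polynomial.C (u A : ℤ) * Polynomial.X + Polynomial.C (v A : ℤ))) = p at *
    generalize S.card = N at *
    constructor
    · refine Polynomial.natDegree_mul_le.trans ?_
      have := Polynomial.natDegree_linear_le (a := (u A : ℤ)) (b := (v A : ℤ))
      omega
    · have h0 : p.coeff (N + 1) = 0 := Polynomial.coeff_eq_zero_of_natDegree_lt (by omega)
      have e : ∀ k, ((Polynomial.C (u A : ℤ) * Polynomial.X + Polynomial.C (v A : ℤ)) * p).coeff k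
          = u A * (Polynomial.X * p).coeff k + v A * p.coeff k := by
        intro k
        rw [add_mul, mul_assoc, Polynomial.coeff_add, Polynomial.coeff_C_mul,
          Polynomial.coeff_C_mul]
      simp only [e]
      simp only [Int.cast_add, Int.cast_mul, Int.cast_natCast, add_mul, Finset.sum_add_distrib]
      congr 1
      · rw [Finset.sum_range_succ' _ (N + 1), Finset.mul_sum]
        simp only [Polynomial.coeff_X_mul, Polynomial.coeff_X_mul_zero, Int.cast_zero, mul_zero,
          zero_mul, add_zero]
        refine Finset.sum_congr rfl fun k _ => ?_
        rw [Nat.add_sub_add_right]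
        ring
      · rw [Finset.sum_range_succ _ (N + 1), h0, Finset.mul_sum]
        simp only [Int.cast_zero, mul_zero, zero_mul, add_zero]
        refine Finset.sum_congr rfl fun k hk => ?_
        rw [Finset.mem_range] at hk
        rw [show N + 1 - k = (N - k) + 1 by omega]
        ring


/-- virtual localization sum, Theorem 7.5 / Definition 7.4 of the paper.
For a field `F` of characteristic zero, integers `n ≥ 1` and `0 ≤ a ≤ n-1`, pairwise
distinct `α_0, …, α_a ∈ F` and pairwise distinct `β_0, …, β_{n-a-1} ∈ F`, the localization
sum equals `τ_{a,n}`, the coefficient of `x^a` in `∏_{A=1}^{n-1} (A·x + (n-A)) ∈ ℤ[x]`. -/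
theorem stmt_0 (F : Type*) [Field F] [CharZero F] (n a : ℕ) (hn : 1 ≤ n) (ha : a ≤ n - 1)
    (α : Fin (a + 1) → F) (hα : Function.Injective α)
    (β : Fin (n - a) → F) (hβ : Function.Injective β) :
    ∑ i : Fin (a + 1), ∑ j : Fin (n - a),
      (∏ A ∈ Finset.Icc 1 (n - 1), ((A : F) * α i + ((n - A : ℕ) : F) * β j)) /
        ((∏ I ∈ Finset.univ.erase i, (α i - α I)) *
          (∏ J ∈ Finset.univ.erase j, (β j - β J)))
      = (((∏ A ∈ Finset.Icc 1 (n - 1),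
            (Polynomial.C (A : ℤ) * Polynomial.X +
              Polynomial.C ((n - A : ℕ) : ℤ))).coeff a : ℤ) : F) := by
  have H : ∀ x y : F, _ := fun x y =>
    (aux_hom (Finset.Icc 1 (n - 1)) (fun A => A) (fun A => n - A) x y).2
  simp only [Nat.card_Icc, Nat.add_sub_cancel] at H
  generalize (∏ A ∈ Finset.Icc 1 (n - 1), (Polynomial.C (A : ℤ) * Polynomial.X +
    Polynomial.C ((n - A : ℕ) : ℤ))) = p at *
  simp only [H]
  have e : ∀ (i : Fin (a + 1)) (j : Fin (n - a)),
      (∑ k ∈ Finset.range (n - 1 + 1), (p.coeff k : F) * (α i ^ k * β j ^ (n - 1 - k))) /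
        ((∏ I ∈ Finset.univ.erase i, (α i - α I)) *
          (∏ J ∈ Finset.univ.erase j, (β j - β J))) =
      ∑ k ∈ Finset.range (n - 1 + 1), (p.coeff k : F) *
        ((α i ^ k / (∏ I ∈ Finset.univ.erase i, (α i - α I))) *
          (β j ^ (n - 1 - k) / (∏ J ∈ Finset.univ.erase j, (β j - β J)))) := by
    intro i j
    rw [Finset.sum_div]
    refine Finset.sum_congr rfl fun k _ => ?_
    rw [mul_div_assoc, mul_div_mul_comm]
  simp only [e]
  have s : ∀ i : Fin (a + 1), ∑ j : Fin (n - a), ∑ k ∈ Finset.range (n - 1 + 1), (p.coeff k : F) *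
        ((α i ^ k / (∏ I ∈ Finset.univ.erase i, (α i - α I))) *
          (β j ^ (n - 1 - k) / (∏ J ∈ Finset.univ.erase j, (β j - β J)))) = _ :=
    fun i => Finset.sum_comm
  simp only [s]
  rw [Finset.sum_comm]
  simp only [← Finset.mul_sum]
  simp only [← Finset.sum_mul]
  rw [Finset.sum_eq_single a]
  · rw [aux_D (a + 1) a (by omega) α hα, aux_D (n - a) (n - 1 - a) (by omega) β hβ,
      if_pos rfl, if_pos (by omega), mul_one, mul_one]
  · intro k hk hka
    rw [Finset.mem_range] at hk
    rcases lt_or_gt_of_ne hka with h | h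
    · rw [aux_D (a + 1) k (by omega) α hα, if_neg (by omega), zero_mul, mul_zero]
    · rw [aux_D (n - a) (n - 1 - k) (by omega) β hβ, if_neg (by omega), mul_zero, mul_zero]
  · intro h
    exact absurd (Finset.mem_range.2 (by omega)) h
end

section
/- Let R be a commutative ring, let m ≥ 1 and 1 ≤ n ≤ m be integers, set N = 1 + m − n, and assume 2N > m. Let t, A_0, …, A_{n−1} ∈ R. Let M be the (m+1)×(m+1) matrix over R, with rows and columns indexed by 0, …, m, whose entries are: M_{i, i+1} = −n (the image of the integer −n in R) for 0 ≤ i ≤ m−1; M_{N−1+a, a} = A_a · t for 0 ≤ a ≤ n−1; and all other entries are 0. Then the characteristic polynomial of M equals X^{m+1} + (−1)^N · n^{N−1} · (A_0 + A_1 + ⋯ + A_{n−1}) · t · X^{m+1−N}. -/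
open Polynomial

/-- The determinant computation over a ring where `x` is invertible. -/
lemma det_aux (S : Type*) [CommRing S] (m n N : ℕ) (hn1 : 1 ≤ n)
    (hnm : n ≤ m) (hN : N = 1 + m - n) (h2N : m < 2 * N) (c x y : S) (hxy : x * y = 1)
    (B : Fin n → S) :
    (Matrix.of (fun i j : Fin (m + 1) =>
        (if j = i then x else 0) + (if (j : ℕ) = (i : ℕ) + 1 then c else 0)
        - (if h : (i : ℕ) = N - 1 + (j : ℕ) ∧ (j : ℕ) < n then B ⟨j, h.2⟩ else 0))).det
      = x ^ (m + 1) + (-1) ^ N * c ^ (N - 1) * (∑ a, B a) * x ^ (m + 1 - N) := by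
  let T : Matrix (Fin (m + 1)) (Fin (m + 1)) S := Matrix.of (fun i j =>
    (if j = i then x else 0) + (if (j : ℕ) = (i : ℕ) + 1 then c else 0))
  let g : ℕ → Fin n → S := fun i a =>
    if i ≤ N - 1 + a then (-c) ^ (N - 1 + a - i) * y ^ (N - 1 + a - i + 1) * B a else 0
  let W : Matrix (Fin (m + 1)) (Fin n) S := Matrix.of (fun i a => g i a)
  let V : Matrix (Fin n) (Fin (m + 1)) S := Matrix.of (fun a j =>
    if (j : ℕ) = a then 1 else 0)
  have hTW : ∀ i a, (T * W) i a = if (i : ℕ) = N - 1 + a then B a else 0 := by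
    intro i a
    have h1 : (T * W) i a = x * g i a + c * g (i + 1) a := by
      simp only [Matrix.mul_apply, T, W, Matrix.of_apply, add_mul, Finset.sum_add_distrib,
        ite_mul, zero_mul, Finset.sum_ite_eq', Finset.mem_univ, if_true, Finset.sum_ite_eq]
      congr 1
      by_cases hi : (i : ℕ) + 1 < m + 1
      · rw [Finset.sum_eq_single (⟨i + 1, hi⟩ : Fin (m + 1))]
        · simp
        · intro b _ hb
          rw [if_neg]
          intro h
          exact hb (Fin.ext h)
        · simp
      · rw [Finset.sum_eq_zero]
        · have := a.2
          have : ¬ ((i : ℕ) + 1 ≤ N - 1 + a) := by omega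
          simp [g, this]
        · intro b _
          have := b.2
          rw [if_neg (by omega)]
    rw [h1]
    simp only [g]
    rcases lt_trichotomy (i : ℕ) (N - 1 + a) with h | h | h
    · rw [if_pos h.le, if_pos (by omega), if_neg h.ne]
      obtain ⟨d, hd⟩ : ∃ d, N - 1 + (a : ℕ) - i = d + 1 := ⟨N - 1 + a - i - 1, by omega⟩
      have hd2 : N - 1 + (a : ℕ) - (i + 1) = d := by omega
      rw [hd, hd2]
      linear_combination (-c) ^ (d + 1) * y ^ (d + 1) * B a * hxy
    · rw [if_pos h.le, if_neg (by omega), if_pos h, ← h]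
      simp
      linear_combination B a * hxy
    · rw [if_neg (by omega), if_neg (by omega), if_neg (by omega)]
      simp
  have hM : (Matrix.of (fun i j : Fin (m + 1) =>
        (if j = i then x else 0) + (if (j : ℕ) = (i : ℕ) + 1 then c else 0)
        - (if h : (i : ℕ) = N - 1 + (j : ℕ) ∧ (j : ℕ) < n then B ⟨j, h.2⟩ else 0)))
      = T * (1 - W * V) := by
    rw [mul_sub, mul_one, ← Matrix.mul_assoc]
    ext i j
    rw [Matrix.sub_apply, Matrix.mul_apply]
    simp only [hTW]
    simp only [Matrix.of_apply, T]
    congr 1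
    simp only [V, Matrix.of_apply, mul_ite, mul_one, mul_zero]
    by_cases hj : (j : ℕ) < n
    · rw [Finset.sum_eq_single (⟨j, hj⟩ : Fin n)]
      · by_cases hi : (i : ℕ) = N - 1 + (j : ℕ) <;> simp [hj, hi]
      · intro b _ hb
        rw [if_neg]
        intro h
        exact hb (Fin.ext h.symm)
      · simp
    · rw [Finset.sum_eq_zero, dif_neg (by tauto)]
      intro b _
      have := b.2
      rw [if_neg (by omega)]
  have hT : T.det = x ^ (m + 1) := by
    rw [Matrix.det_of_upperTriangular]
    · simp [T]
    · intro i j hij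
      have hij' : (j : ℕ) < i := hij
      simp only [T, Matrix.of_apply]
      rw [if_neg (by intro h; rw [h] at hij'; omega), if_neg (by omega), add_zero]
  let u : Matrix (Fin n) (Fin 1) S := Matrix.of (fun a _ => (-c) ^ (N - 1 - (a : ℕ)) * x ^ (a : ℕ))
  let w : Matrix (Fin 1) (Fin n) S := Matrix.of (fun _ b =>
    (-c) ^ (b : ℕ) * y ^ (N + (b : ℕ)) * B b)
  have hxyk : ∀ k : ℕ, x ^ k * y ^ k = 1 := fun k => by rw [← mul_pow, hxy, one_pow]
  have hVW : V * W = u * w := by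
    ext a b
    have ha := a.2
    have h1 : (V * W) a b = g a b := by
      simp only [Matrix.mul_apply, V, W, Matrix.of_apply]
      rw [Finset.sum_eq_single (⟨a, by omega⟩ : Fin (m + 1))]
      · simp
      · intro k _ hk
        rw [if_neg, zero_mul]
        intro h
        exact hk (Fin.ext h)
      · simp
    rw [h1]
    simp only [g, u, w, Matrix.mul_apply, Matrix.of_apply, Finset.univ_unique, Finset.sum_singleton]
    rw [if_pos (by omega)]
    have e1 : N - 1 + (b : ℕ) - a = (N - 1 - a) + b := by omega
    have e2 : N + (b : ℕ) = (N - 1 - a + b + 1) + a := by omega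
    rw [e1, e2, pow_add (-c), pow_add y _ (a : ℕ)]
    linear_combination (-((-c) ^ (N - 1 - (a : ℕ)) * (-c) ^ (b : ℕ) *
      y ^ (N - 1 - (a : ℕ) + b + 1) * B b)) * hxyk a
  rw [hM, Matrix.det_mul, hT, Matrix.det_one_sub_mul_comm, hVW, Matrix.det_one_sub_mul_comm,
    Matrix.det_fin_one, Matrix.sub_apply, Matrix.one_apply_eq, Matrix.mul_apply]
  have hs : ∑ j, w 0 j * u j 0 = (-c) ^ (N - 1) * y ^ N * ∑ a, B a := by
    rw [Finset.mul_sum]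
    refine Finset.sum_congr rfl fun a _ => ?_
    have ha := a.2
    simp only [u, w, Matrix.of_apply]
    have e1 : N - 1 = (N - 1 - a) + a := by omega
    have e3 : (-c) ^ (N - 1) = (-c) ^ (N - 1 - (a : ℕ)) * (-c) ^ (a : ℕ) := by
      rw [← pow_add, ← e1]
    rw [e3, pow_add y]
    linear_combination ((-c) ^ (N - 1 - (a : ℕ)) * (-c) ^ (a : ℕ) * y ^ N * B a) * hxyk a
  rw [hs]
  obtain ⟨k, rfl⟩ : ∃ k, N = k + 1 := ⟨N - 1, by omega⟩
  have e4 : x ^ (m + 1) = x ^ (m + 1 - (k + 1)) * x ^ (k + 1) := by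
    rw [← pow_add]; congr 1; omega
  rw [e4, Nat.add_sub_cancel, neg_pow c]
  linear_combination (-(x ^ (m + 1 - (k + 1)) * ((-1) ^ k * c ^ k) * ∑ a, B a)) * hxyk (k + 1)

/-- Lemma 7.6 of the paper. The characteristic polynomial of the
matrix of `r` (quantum product by `c₁(O(-n))`) on `QH*(Tot(O(-n) → ℙ^m))` in the basis
`ω^m, …, ω, 1`, when `2N > m` with `N = 1 + m - n`:
its only nonzero entries are `M_{i,i+1} = -n` (for `0 ≤ i ≤ m-1`) and
`M_{N-1+a, a} = A_a · t` (for `0 ≤ a ≤ n-1`), and its characteristic polynomial is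
`X^{m+1} + (-1)^N n^{N-1} (∑ A_a) t · X^{m+1-N}`. -/
theorem stmt_1 (R : Type*) [CommRing R] (m n N : ℕ) (hm : 1 ≤ m) (hn1 : 1 ≤ n)
    (hnm : n ≤ m) (hN : N = 1 + m - n) (h2N : m < 2 * N) (t : R) (A : Fin n → R) :
    (Matrix.of (fun i j : Fin (m + 1) =>
        if (j : ℕ) = (i : ℕ) + 1 then (-(n : R))
        else if h : (i : ℕ) = N - 1 + (j : ℕ) ∧ (j : ℕ) < n then A ⟨j, h.2⟩ * t
        else 0)).charpoly
      = X ^ (m + 1) +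
          C ((-1 : R) ^ N * (n : R) ^ (N - 1) * (∑ a, A a) * t) * X ^ (m + 1 - N) := by
  apply Polynomial.toLaurent_injective
  rw [Matrix.charpoly, RingHom.map_det]
  have key := det_aux (LaurentPolynomial R) m n N hn1 hnm hN h2N
    (n : LaurentPolynomial R) (LaurentPolynomial.T 1) (LaurentPolynomial.T (-1))
    (by rw [← LaurentPolynomial.T_add]; simp) (fun a => LaurentPolynomial.C (A a * t))
  convert key using 1
  · congr 1
    ext1 i j
    simp only [RingHom.mapMatrix_apply, Matrix.map_apply, Matrix.charmatrix_apply,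
      Matrix.of_apply, Matrix.diagonal_apply]
    by_cases h1 : (j : ℕ) = i + 1
    · have h2 : ¬ (i = j) := by intro h; rw [h] at h1; omega
      have h3 : ¬ ((i : ℕ) = N - 1 + (j : ℕ) ∧ (j : ℕ) < n) := by omega
      rw [if_pos h1, if_pos h1, if_neg h2, if_neg (Ne.symm h2), dif_neg h3]
      simp
    · rw [if_neg h1, if_neg h1]
      simp only [eq_comm (a := j) (b := i)]
      split_ifs <;> simp [Polynomial.toLaurent_X]
  · simp only [map_add, map_mul, map_pow, Polynomial.toLaurent_X, Polynomial.toLaurent_C,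
      map_neg, map_one, map_natCast, map_sum, ← Finset.sum_mul]
    ring
end

section
/- Let K be a field of characteristic zero, let t ∈ K with t ≠ 0, and let m, n be integers with 1 ≤ n and 2n < 2 + m (i.e. n < 1 + m/2); set N = 1 + m − n. Let R = K[X]/(X^{m+1} + n^n·t·X^n) and let x denote the image of X in R. Then for every integer k ≥ n, the quotient of R by the ideal ker(multiplication by x^k) is isomorphic as a K-algebra to K[X]/(X^N + n^n·t); in particular this quotient has dimension N over K. -/
set_option synthInstance.maxHeartbeats 1000000
set_option maxHeartbeats 1000000

open Polynomial

/-- Theorem 1.6 of the paper, algebraic content. For a field `K` of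
characteristic zero, `t ≠ 0`, `1 ≤ n` with `2n < 2 + m`, `N = 1 + m - n`, and
`R = K[X]/(X^{m+1} + n^n·t·X^n)` with `x` the image of `X`: for every `k ≥ n`, the
quotient of `R` by the ideal `ker(multiplication by x^k)` is isomorphic as a
`K`-algebra to `K[X]/(X^N + n^n·t)`; in particular it has `K`-dimension `N`. -/
theorem stmt_6 (K : Type*) [Field K] [CharZero K] (t : K) (ht : t ≠ 0) (m n N : ℕ)
    (hn : 1 ≤ n) (hmn : 2 * n < 2 + m) (hN : N = 1 + m - n)
    (k : ℕ) (hk : n ≤ k)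
    (I : Ideal (K[X] ⧸ Ideal.span {X ^ (m + 1) + C ((n : K) ^ n * t) * X ^ n}))
    (hI : ∀ r, r ∈ I ↔
      (Ideal.Quotient.mk (Ideal.span {X ^ (m + 1) + C ((n : K) ^ n * t) * X ^ n}) X) ^ k
        * r = 0) :
    Nonempty (((K[X] ⧸ Ideal.span {X ^ (m + 1) + C ((n : K) ^ n * t) * X ^ n}) ⧸ I)
        ≃ₐ[K] (K[X] ⧸ Ideal.span {X ^ N + C ((n : K) ^ n * t)})) ∧
      Module.finrank K
        ((K[X] ⧸ Ideal.span {X ^ (m + 1) + C ((n : K) ^ n * t) * X ^ n}) ⧸ I) = N := by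
  have hc : (n : K) ^ n * t ≠ 0 :=
    mul_ne_zero (pow_ne_zero _ (Nat.cast_ne_zero.mpr (by omega))) ht
  generalize (n : K) ^ n * t = c at *
  have hN1 : 0 < N := by omega
  have hfac : (X ^ (m + 1) + C c * X ^ n : K[X]) = X ^ n * (X ^ N + C c) := by
    have : m + 1 = n + N := by omega
    rw [this]; ring
  have hcop : IsCoprime (X ^ N + C c : K[X]) (X ^ k) := by
    apply IsCoprime.pow_right
    refine ⟨C c⁻¹, - C c⁻¹ * X ^ (N - 1), ?_⟩
    have h1 : (X : K[X]) ^ N = X ^ (N - 1) * X := by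
      rw [← pow_succ]; congr 1; omega
    have h2 : (C c⁻¹ * C c : K[X]) = 1 := by
      rw [← C_mul, inv_mul_cancel₀ hc, C_1]
    rw [h1]
    linear_combination h2
  have hle : Ideal.span {(X ^ (m + 1) + C c * X ^ n : K[X])} ≤
      Ideal.span {(X ^ N + C c : K[X])} := by
    rw [Ideal.span_singleton_le_span_singleton, hfac]
    exact dvd_mul_left _ _
  have hIeq : I = (Ideal.span {(X ^ N + C c : K[X])}).map
      (Ideal.Quotient.mkₐ K (Ideal.span {(X ^ (m + 1) + C c * X ^ n : K[X])})) := by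
    ext r
    obtain ⟨p, rfl⟩ := Ideal.Quotient.mk_surjective r
    rw [hI, ← map_pow, ← map_mul, Ideal.Quotient.eq_zero_iff_mem, Ideal.mem_span_singleton]
    constructor
    · intro h
      have h1 : (X ^ N + C c : K[X]) ∣ p :=
        hcop.dvd_of_dvd_mul_left ((hfac ▸ dvd_mul_left _ _).trans h)
      exact Ideal.mem_map_of_mem (Ideal.Quotient.mkₐ K _) (Ideal.mem_span_singleton.mpr h1)
    · intro h
      have h' : Ideal.Quotient.mk (Ideal.span {(X ^ (m + 1) + C c * X ^ n : K[X])}) p ∈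
        (Ideal.span {(X ^ N + C c : K[X])}).map
          (Ideal.Quotient.mk (Ideal.span {(X ^ (m + 1) + C c * X ^ n : K[X])})) := h
      rw [Ideal.mem_quotient_iff_mem hle, Ideal.mem_span_singleton] at h'
      rw [hfac]
      exact mul_dvd_mul (pow_dvd_pow _ hk) h'
  subst hIeq
  have e := DoubleQuot.quotQuotEquivQuotOfLEₐ K hle
  refine ⟨⟨e⟩, ?_⟩
  rw [e.toLinearEquiv.finrank_eq, finrank_quotient_span_eq_natDegree, natDegree_X_pow_add_C]
end

section
/- Let V be a real vector space, let ω : V × V → ℝ be an alternating bilinear form, and let J : V → V be a linear map satisfying J∘J = −id, ω(Ju, Jv) = ω(u, v) for all u, v ∈ V, and ω(v, Jv) > 0 for all v ≠ 0. Fix X ∈ V and a real number κ > 0. On W = ℝ × ℝ × V define the bilinear form Ω((a,b,m),(a',b',m')) = ω(m − bX, m' − b'X) + (ab' − a'b)·κ and the linear map Ĵ(a,b,m) = (−b, a, Jm + aX − b·JX). Then: (i) Ĵ∘Ĵ = −id_W; (ii) Ω is alternating and Ω(Ĵv, Ĵw) = Ω(v, w) for all v, w ∈ W; (iii) Ω(v,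 Ĵv) > 0 for every v ≠ 0 in W. In particular Ω is a nondegenerate alternating form compatible with Ĵ. -/
/-- pointwise linear algebra of Lemma 4.4 of the paper. Given a
symplectic vector space `(V, ω)` with compatible complex structure `J`, a vector
`X ∈ V` and `κ > 0`, the form `Ω` and the map `Ĵ` on `W = ℝ × ℝ × V` defined by
`Ω((a,b,m),(a',b',m')) = ω(m - bX, m' - b'X) + (ab' - a'b)κ` and
`Ĵ(a,b,m) = (-b, a, Jm + aX - b·JX)` satisfy: `Ĵ∘Ĵ = -id`; `Ω` is alternating and
`Ĵ`-invariant; `Ω(w, Ĵw) > 0` for `w ≠ 0`; and `Ω` is nondegenerate. -/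
theorem stmt_12 (V : Type*) [AddCommGroup V] [Module ℝ V]
    (ω : V →ₗ[ℝ] V →ₗ[ℝ] ℝ) (J : V →ₗ[ℝ] V)
    (halt : ∀ v, ω v v = 0)
    (hJJ : ∀ v, J (J v) = -v)
    (hcompat : ∀ u v, ω (J u) (J v) = ω u v)
    (hpos : ∀ v, v ≠ 0 → 0 < ω v (J v))
    (X : V) (κ : ℝ) (hκ : 0 < κ)
    (Ω : ℝ × ℝ × V → ℝ × ℝ × V → ℝ)
    (hΩ : ∀ p q, Ω p q =
      ω (p.2.2 - p.2.1 • X) (q.2.2 - q.2.1 • X) + (p.1 * q.2.1 - q.1 * p.2.1) * κ)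
    (Jh : ℝ × ℝ × V → ℝ × ℝ × V)
    (hJh : ∀ p, Jh p = (-p.2.1, p.1, J p.2.2 + p.1 • X - p.2.1 • J X)) :
    (∀ w, Jh (Jh w) = -w) ∧
    (∀ w, Ω w w = 0) ∧
    (∀ v w, Ω (Jh v) (Jh w) = Ω v w) ∧
    (∀ w, w ≠ 0 → 0 < Ω w (Jh w)) ∧
    (∀ v, (∀ w, Ω v w = 0) → v = 0) := by
  have key : ∀ p : ℝ × ℝ × V, (Jh p).2.2 - (Jh p).2.1 • X = J (p.2.2 - p.2.1 • X) := by
    intro p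
    rw [hJh]
    simp only [map_sub, map_smul]
    abel
  have h1 : ∀ p, (Jh p).1 = -p.2.1 := fun p => by rw [hJh]
  have h2 : ∀ p, (Jh p).2.1 = p.1 := fun p => by rw [hJh]
  have hp : ∀ w, w ≠ 0 → 0 < Ω w (Jh w) := by
    rintro ⟨a, b, m⟩ hw
    rw [hΩ, key, h1, h2]
    simp only
    by_cases hm : m - b • X = 0
    · have hab : 0 < a * a + b * b := by
        by_contra hn
        have ha : a = 0 := by nlinarith [mul_self_nonneg a, mul_self_nonneg b]
        have hb : b = 0 := by nlinarith [mul_self_nonneg a, mul_self_nonneg b]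
        apply hw
        subst ha hb
        simpa using hm
      have := mul_pos hab hκ
      rw [hm]
      simp only [map_zero]
      linarith
    · have := hpos _ hm
      have h3 : 0 ≤ (a * a + b * b) * κ :=
        mul_nonneg (add_nonneg (mul_self_nonneg a) (mul_self_nonneg b)) hκ.le
      linarith
  refine ⟨?_, ?_, ?_, hp, ?_⟩
  · rintro ⟨a, b, m⟩
    rw [hJh, hJh]
    refine Prod.ext rfl (Prod.ext rfl ?_)
    simp only [map_add, map_sub, map_smul, hJJ, Prod.snd_neg, neg_smul, smul_neg]
    abel
  · intro w
    rw [hΩ, halt]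
    ring
  · intro v w
    rw [hΩ, hΩ, key, key, hcompat, h1, h1, h2, h2]
    ring
  · intro v hv
    by_contra hne
    exact (hp v hne).ne' (hv _)
end
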